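/- Let p ≥ q ≥ r be positive integers with gcd(p,q,r)=1, t = gcd(p,q), r₁ = p/t, r₂ = q/t. Let S ⊆ {1,...,n} contain no solution (x,y,z) ∈ S³ to px+qy=rz. If M ∈ S is divisible by t, then |S ∩ {1, ..., ⌈rM/q⌉−1}| ≤ ⌈rM/q⌉ − 1 − ⌊rM/(r₂(p+q))⌋ − (r₁r₂ − r₁ − r₂ + 1)·⌊⌊rM/(r₁(p+q)) − 1/r₂⌋/(r₁r₂)⌋. -/

import Mathlib

lemma aux_periodic (P : ℕ → Prop) [DecidablePred P] (c : ℕ) (hP : Function.Periodic P c) (k : ℕ) :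
    ((Finset.Ico 1 (1 + c * k)).filter P).card = k * ((Finset.Ico 0 c).filter P).card := by
  induction k with
  | zero => simp
  | succ k ih =>
    have h1 : Finset.Ico 1 (1 + c * (k+1)) =
        Finset.Ico 1 (1 + c * k) ∪ Finset.Ico (1 + c * k) (1 + c * k + c) := by
      ext x; simp only [Finset.mem_union, Finset.mem_Ico, mul_add]
      constructor
      · intro h; omega
      · intro h; rcases h with h | h <;> constructor <;> nlinarith [Nat.zero_le (c * k)]
    have hd : Disjoint (Finset.Ico 1 (1 + c * k)) (Finset.Ico (1 + c * k) (1 + c * k + c)) := by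
      exact Finset.Ico_disjoint_Ico_consecutive _ _ _
    rw [h1, Finset.filter_union, Finset.card_union_of_disjoint
      (Finset.disjoint_filter_filter hd), ih, Nat.filter_Ico_card_eq_of_periodic _ _ _ hP]
    have := Nat.filter_Ico_card_eq_of_periodic 0 c P hP
    rw [zero_add] at this
    rw [this]; ring

lemma aux_solve (c d e : ℤ) (h : IsCoprime c d) : ∃ y, d ∣ c * y - e := by
  obtain ⟨s, t, hst⟩ := h
  exact ⟨s * e, -t * e, by linear_combination e * hst⟩

lemma aux_lower (P : ℕ → Prop) [DecidablePred P] (c L m : ℕ) (hP : Function.Periodic P c)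
    (hm : m ≤ ((Finset.Ico 0 c).filter P).card) :
    (L / c) * m ≤ ((Finset.Icc 1 L).filter P).card := by
  calc (L / c) * m ≤ (L / c) * ((Finset.Ico 0 c).filter P).card := Nat.mul_le_mul_left _ hm
    _ = _ := (aux_periodic P c hP (L / c)).symm
    _ ≤ _ := by
      apply Finset.card_le_card
      apply Finset.filter_subset_filter
      intro x hx
      simp only [Finset.mem_Ico, Finset.mem_Icc] at hx ⊢
      have := Nat.mul_div_le L c
      omega

def PA (a b N : ℕ) (x : ℕ) : Prop := (b : ℤ) ∣ N - a * x

def PB (a b N : ℕ) (y : ℕ) : Prop :=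
  (a : ℤ) ∣ N - b * y ∧ ¬ (b : ℤ) ∣ N - a * y ∧ ¬ ((a : ℤ) ^ 2 ∣ a * N - b * (N - b * y))

lemma cast_rep (z : ℤ) (c : ℕ) (hc : 0 < c) : ∃ y : ℕ, y < c ∧ (c : ℤ) ∣ (y : ℤ) - z := by
  have h0 : (0 : ℤ) < c := by exact_mod_cast hc
  refine ⟨(z % c).toNat, ?_, ?_⟩
  · have := Int.emod_lt_of_pos z h0
    have := Int.emod_nonneg z h0.ne'
    omega
  · rw [Int.toNat_of_nonneg (Int.emod_nonneg z h0.ne')]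
    exact ⟨-(z / c), by linear_combination Int.emod_add_mul_ediv z c⟩

open Classical in
lemma countA (a b N L : ℕ) (hb : 0 < b) (hab : Nat.Coprime a b) :
    L / b ≤ ((Finset.Icc 1 L).filter (PA a b N)).card := by
  have := aux_lower (PA a b N) b L 1 ?_ ?_
  · simpa using this
  · intro x
    unfold PA
    apply propext
    push_cast
    rw [show (N : ℤ) - a * (x + b) = N - a * x - b * a by ring]
    exact dvd_sub_left (dvd_mul_right _ _)
  · rw [Nat.one_le_iff_ne_zero, Finset.card_ne_zero]
    obtain ⟨z, hz⟩ := aux_solve a b N (Nat.isCoprime_iff_coprime.mpr hab)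
    obtain ⟨y, hy, hyz⟩ := cast_rep z b hb
    refine ⟨y, ?_⟩
    simp only [Finset.mem_filter, Finset.mem_Ico, PA]
    refine ⟨⟨Nat.zero_le _, hy⟩, ?_⟩
    rw [show (N : ℤ) - a * y = -(a * z - N) - a * (y - z) by ring]
    exact dvd_sub (dvd_neg.mpr hz) (hyz.mul_left _)

open Classical in
lemma countB (a b N L : ℕ) (ha : 0 < a) (hb : 0 < b) (hab : Nat.Coprime a b) :
    (L / (a ^ 2 * b)) * ((a - 1) * (b - 1)) ≤ ((Finset.Icc 1 L).filter (PB a b N)).card := by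
  have hc : IsCoprime (a : ℤ) b := Nat.isCoprime_iff_coprime.mpr hab
  apply aux_lower
  · intro x
    unfold PB
    apply propext
    push_cast
    rw [show (N : ℤ) - b * (x + a ^ 2 * b) = N - b * x - a * (a * b ^ 2) by ring,
      show (N : ℤ) - a * (x + a ^ 2 * b) = N - a * x - b * (a ^ 3) by ring,
      show (a : ℤ) * N - b * (N - b * x - a * (a * b ^ 2))
        = a * N - b * (N - b * x) + a ^ 2 * (b ^ 3) by ring,
      dvd_sub_left (dvd_mul_right _ _), dvd_sub_left (dvd_mul_right _ _),
      dvd_add_left (dvd_mul_right _ _)]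
  · have key : ∀ w : ℕ × ℕ, ∃ y : ℕ, y < a ^ 2 * b ∧
        ((a : ℤ) ^ 2 ∣ a * N - b * (N - b * y) - a * w.1) ∧ ((b : ℤ) ∣ N - a * y - w.2) := by
      rintro ⟨u, v⟩
      obtain ⟨y1, h1⟩ := aux_solve ((b : ℤ) ^ 2) ((a : ℤ) ^ 2) (b * N - a * N + a * u)
        (hc.symm.pow)
      obtain ⟨y2, h2⟩ := aux_solve a b (N - v) hc
      obtain ⟨s, t, hst⟩ : IsCoprime ((a : ℤ) ^ 2) b := hc.pow_left
      obtain ⟨y, hy, hyz⟩ := cast_rep (y2 * s * a ^ 2 + y1 * t * b) (a ^ 2 * b) (by positivity)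
      refine ⟨y, hy, ?_, ?_⟩
      · obtain ⟨k, hk⟩ := hyz
        obtain ⟨l, hl⟩ := h1
        push_cast at hk
        refine ⟨b ^ 3 * k + b ^ 2 * (y2 - y1) * s + l, ?_⟩
        linear_combination hl + (b : ℤ) ^ 2 * hk + b ^ 2 * y1 * hst
      · obtain ⟨k, hk⟩ := hyz
        obtain ⟨l, hl⟩ := h2
        push_cast at hk
        refine ⟨- a ^ 3 * k - a * (y1 - y2) * t - l, ?_⟩
        linear_combination -hl - a * hk - a * y2 * hst
    choose F hF using key
    have hcard : ((Finset.Ico 1 a) ×ˢ (Finset.Ico 1 b)).card = (a - 1) * (b - 1) := by simp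
    rw [← hcard]
    have small : ∀ (c : ℕ) (x y : ℕ), x < c → y < c → (c : ℤ) ∣ x - y → x = y := by
      intro c x y hx hy h
      have := (Nat.modEq_iff_dvd.mpr h : y ≡ x [MOD c])
      exact (Nat.ModEq.eq_of_lt_of_lt this hy hx).symm
    have ha0 : (a : ℤ) ≠ 0 := by positivity
    have cancel : ∀ z : ℤ, (a : ℤ) ^ 2 ∣ a * z → (a : ℤ) ∣ z := by
      intro z h
      rw [sq] at h
      exact (mul_dvd_mul_iff_left ha0).mp h
    apply Finset.card_le_card_of_injOn F
    · rintro ⟨u, v⟩ hw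
      simp only [Finset.coe_product, Finset.coe_Ico, Set.mem_prod, Set.mem_Ico] at hw
      obtain ⟨h1, h2, h3⟩ := hF (u, v)
      simp only at h2 h3
      simp only [Finset.coe_filter, Finset.mem_Ico, Set.mem_setOf_eq, PB]
      refine ⟨⟨Nat.zero_le _, h1⟩, ?_, ?_, ?_⟩
      · have h4 : (a : ℤ) ∣ b * (N - b * F (u, v)) := by
          have h5 : (a : ℤ) ∣ _ := dvd_trans (dvd_pow_self _ two_ne_zero) h2
          have h6 := (dvd_mul_right (a : ℤ) (N - u)).sub h5
          have h7 : (b : ℤ) * (N - b * F (u, v)) = a * (N - u) -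
              (a * N - b * (N - b * F (u, v)) - a * u) := by ring
          rw [h7]; exact h6
        exact hc.dvd_of_dvd_mul_left h4
      · intro h
        have h4 := h.sub h3
        rw [sub_sub_cancel] at h4
        have := small b v 0 (by omega) (by omega) (by simpa using h4)
        omega
      · intro h
        have h4 := h.sub h2
        rw [sub_sub_cancel] at h4
        have := small a u 0 (by omega) (by omega) (by simpa using cancel _ h4)
        omega
    · rintro ⟨u, v⟩ hw ⟨u', v'⟩ hw' he
      simp only [Finset.coe_product, Finset.coe_Ico, Set.mem_prod, Set.mem_Ico] at hw hw'
      obtain ⟨h1, h2, h3⟩ := hF (u, v)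
      obtain ⟨h1', h2', h3'⟩ := hF (u', v')
      rw [← he] at h2' h3'
      simp only at h2 h3 h2' h3'
      have e1 := h2'.sub h2
      have e2 := h3'.sub h3
      rw [sub_sub_sub_cancel_left] at e1 e2
      rw [← mul_sub] at e1
      rw [small a u u' (by omega) (by omega) (cancel _ e1),
        small b v v' (by omega) (by omega) e2]

open Classical in
lemma core (a b N K : ℕ) (hb : 0 < b) (hba : b ≤ a) (hN : 0 < N) (hab : Nat.Coprime a b)
    (hK : ∀ x, x ≤ K ↔ x * b < N) (S : Finset ℕ) (hS : ∀ x ∈ S, 0 < x)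
    (hfree : ∀ x ∈ S, ∀ y ∈ S, a * x + b * y ≠ N) :
    (S.filter (fun x => x ≤ K)).card + N / (a + b) / b +
      (N / (a + b) / (a ^ 2 * b)) * ((a - 1) * (b - 1)) ≤ K := by
  have ha : 0 < a := by omega
  set L := N / (a + b) with hL
  have hLx : ∀ x, x ≤ L ↔ x * (a + b) ≤ N := fun x => Nat.le_div_iff_mul_le (by omega)
  set A := (Finset.Icc 1 L).filter (PA a b N) with hA
  set B := (Finset.Icc 1 L).filter (PB a b N) with hB
  have cA := countA a b N L hb hab
  have cB := countB a b N L ha hb hab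
  rw [← hA] at cA
  rw [← hB] at cB
  have hdis : Disjoint A B := by
    rw [Finset.disjoint_left]
    intro x hx hx'
    simp only [hA, hB, Finset.mem_filter, PA, PB] at hx hx'
    exact hx'.2.2.1 hx.2
  have pA : ∀ x ∈ A, ∃ y : ℕ, a * x + b * y = N := by
    intro x hx
    simp only [hA, Finset.mem_filter, Finset.mem_Icc, PA] at hx
    obtain ⟨⟨_, h1⟩, k, hk⟩ := hx
    rw [hLx] at h1
    have hk0 : 0 ≤ k := by
      have h1' : (x : ℤ) * (a + b) ≤ N := by exact_mod_cast h1
      have : (0 : ℤ) ≤ b * k := by rw [← hk]; nlinarith [mul_nonneg (Int.natCast_nonneg x) (Int.natCast_nonneg b)]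
      exact nonneg_of_mul_nonneg_right this (by exact_mod_cast hb)
    lift k to ℕ using hk0
    exact ⟨k, by zify; linarith⟩
  have pB : ∀ x ∈ B, ∃ y : ℕ, a * y + b * x = N := by
    intro x hx
    simp only [hB, Finset.mem_filter, Finset.mem_Icc, PB] at hx
    obtain ⟨⟨_, h1⟩, ⟨k, hk⟩, _⟩ := hx
    rw [hLx] at h1
    have hk0 : 0 ≤ k := by
      have h1' : (x : ℤ) * (a + b) ≤ N := by exact_mod_cast h1
      have : (0 : ℤ) ≤ a * k := by rw [← hk]; nlinarith [mul_nonneg (Int.natCast_nonneg x) (Int.natCast_nonneg a)]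
      exact nonneg_of_mul_nonneg_right this (by exact_mod_cast ha)
    lift k to ℕ using hk0
    exact ⟨k, by zify; linarith⟩
  have pAB : ∀ x, ∃ y : ℕ, (x ∈ A → a * x + b * y = N) ∧ (x ∈ B → a * y + b * x = N) := by
    intro x
    by_cases hx : x ∈ A
    · obtain ⟨y, hy⟩ := pA x hx
      exact ⟨y, fun _ => hy, fun h => absurd h (Finset.disjoint_left.mp hdis hx)⟩
    · by_cases hx' : x ∈ B
      · obtain ⟨y, hy⟩ := pB x hx'
        exact ⟨y, fun h => absurd h hx, fun _ => hy⟩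
      · exact ⟨0, fun h => absurd h hx, fun h => absurd h hx'⟩
  choose f hfA hfB using pAB
  have mem : ∀ x ∈ A ∪ B, 0 < x ∧ x * (a + b) ≤ N := by
    intro x hx
    rw [Finset.mem_union] at hx
    rcases hx with hx | hx
    · simp only [hA, Finset.mem_filter, Finset.mem_Icc] at hx
      exact ⟨hx.1.1, (hLx x).mp hx.1.2⟩
    · simp only [hB, Finset.mem_filter, Finset.mem_Icc] at hx
      exact ⟨hx.1.1, (hLx x).mp hx.1.2⟩
  have fbig : ∀ x ∈ A ∪ B, N ≤ f x * (a + b) := by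
    intro x hx
    obtain ⟨_, h2⟩ := mem x hx
    by_contra hlt
    push Not at hlt
    rw [Finset.mem_union] at hx
    rcases hx with hx | hx
    · have := hfA x hx
      have h3 : f x < x ∨ x ≤ f x := lt_or_ge _ _
      nlinarith
    · have := hfB x hx
      nlinarith
  have feq : ∀ x ∈ A ∪ B, f x * (a + b) = N → x * (a + b) = N := by
    intro x hx he
    rw [Finset.mem_union] at hx
    rcases hx with hx | hx
    · have := hfA x hx
      have : a * x = a * f x := by linarith
      rw [Nat.eq_of_mul_eq_mul_left ha this, he]
    · have := hfB x hx
      have : b * x = b * f x := by linarith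
      rw [Nat.eq_of_mul_eq_mul_left hb this, he]
  have flt : ∀ x ∈ A ∪ B, 0 < f x ∧ f x * b < N := by
    intro x hx
    obtain ⟨h1, h2⟩ := mem x hx
    have h3 := fbig x hx
    have h4 : 0 < f x := by
      rcases Nat.eq_zero_or_pos (f x) with h | h
      · rw [h] at h3; omega
      · exact h
    refine ⟨h4, ?_⟩
    rw [Finset.mem_union] at hx
    rcases hx with hx | hx
    · have := hfA x hx
      have := Nat.mul_pos ha h1
      nlinarith
    · have := hfB x hx
      have := Nat.mul_pos hb h1
      have := Nat.mul_le_mul_left (f x) hba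
      nlinarith
  have fS : ∀ x ∈ A ∪ B, x ∈ S → f x ∉ S := by
    intro x hx hxS hfS
    rw [Finset.mem_union] at hx
    rcases hx with hx | hx
    · exact hfree x hxS _ hfS (hfA x hx)
    · exact hfree _ hfS x hxS (hfB x hx)
  have cross : ∀ x ∈ A, ∀ y ∈ B, f x ≠ f y := by
    intro x hx y hy he
    have h1 := hfA x hx
    have h2 := hfB y hy
    simp only [hB, Finset.mem_filter, PB] at hy
    apply hy.2.2.2
    rw [← he] at h2
    refine ⟨x, ?_⟩
    zify at h1 h2
    linear_combination (-(b : ℤ)) * h2 * (-1 : ℤ) * (-1) + b * h2 - a * h1 + b * h2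
  have finj : ∀ x ∈ A ∪ B, ∀ y ∈ A ∪ B, f x = f y → x = y := by
    intro x hx y hy he
    rw [Finset.mem_union] at hx hy
    rcases hx with hx | hx <;> rcases hy with hy | hy
    · have h1 := hfA x hx
      have h2 := hfA y hy
      rw [← he] at h2
      exact Nat.eq_of_mul_eq_mul_left ha (by linarith)
    · exact absurd he (cross x hx y hy)
    · exact absurd he.symm (cross y hy x hx)
    · have h1 := hfB x hx
      have h2 := hfB y hy
      rw [← he] at h2
      exact Nat.eq_of_mul_eq_mul_left hb (by linarith)
  have hmain : (A ∪ B).card ≤ ((Finset.Icc 1 K) \ S).card := by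
    apply Finset.card_le_card_of_injOn (fun x => if x ∈ S then f x else x)
    · intro x hx
      rw [Finset.mem_coe] at hx
      obtain ⟨h1, h2⟩ := mem x hx
      obtain ⟨h3, h4⟩ := flt x hx
      simp only [Finset.coe_sdiff, Set.mem_diff, Finset.mem_coe, Finset.mem_Icc]
      split_ifs with h
      · exact ⟨⟨h3, (hK _).mpr h4⟩, fS x hx h⟩
      · refine ⟨⟨h1, (hK _).mpr ?_⟩, h⟩
        have := Nat.mul_pos h1 ha
        nlinarith
    · have mixed : ∀ x ∈ A ∪ B, ∀ y ∈ A ∪ B, f x = y → x = y := by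
        intro x hx y hy he
        have h1 := fbig x hx
        have h2 := (mem y hy).2
        rw [← he] at h2
        have h3 := feq x hx (le_antisymm h2 h1)
        rw [← he]
        exact Nat.eq_of_mul_eq_mul_right (by omega : 0 < a + b) (by linarith)
      intro x hx y hy he
      rw [Finset.mem_coe] at hx hy
      simp only at he
      split_ifs at he
      · exact finj x hx y hy he
      · exact mixed x hx y hy he
      · exact (mixed y hy x hx he.symm).symm
      · exact he
  rw [Finset.card_union_of_disjoint hdis] at hmain
  have hS2 : S.filter (fun x => x ≤ K) = (Finset.Icc 1 K) ∩ S := by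
    ext x
    simp only [Finset.mem_filter, Finset.mem_inter, Finset.mem_Icc]
    constructor
    · rintro ⟨h1, h2⟩; exact ⟨⟨hS x h1, h2⟩, h1⟩
    · rintro ⟨⟨_, h2⟩, h1⟩; exact ⟨h1, h2⟩
  have h5 := Finset.card_inter_add_card_sdiff (Finset.Icc 1 K) S
  rw [Nat.card_Icc] at h5
  rw [hS2]
  omega

theorem stmt3 (p q r n M t r₁ r₂ : ℕ) (hqp : q ≤ p) (hrq : r ≤ q) (hr : 0 < r)
    (hgcd : Nat.gcd (Nat.gcd p q) r = 1) (ht : t = Nat.gcd p q)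
    (hr1 : r₁ = p / t) (hr2 : r₂ = q / t)
    (S : Finset ℕ) (hS : S ⊆ Finset.Icc 1 n)
    (hfree : ∀ x ∈ S, ∀ y ∈ S, ∀ z ∈ S, p * x + q * y ≠ r * z)
    (hM : M ∈ S) (htM : t ∣ M) :
    ((S.filter (fun x : ℕ => (x : ℤ) ≤ ⌈(r * M : ℚ) / q⌉ - 1)).card : ℤ) ≤
      ⌈(r * M : ℚ) / q⌉ - 1 - (r * M / (r₂ * (p + q)) : ℕ) -
        ((r₁ : ℤ) * r₂ - r₁ - r₂ + 1) *
          Int.fdiv ⌊(r * M : ℚ) / (r₁ * (p + q)) - 1 / r₂⌋ (r₁ * r₂) := by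
  have hq0 : 0 < q := by omega
  have ht0 : 0 < t := ht ▸ Nat.gcd_pos_of_pos_right _ hq0
  have hpe : p = t * r₁ := by rw [hr1, Nat.mul_div_cancel' (ht ▸ Nat.gcd_dvd_left p q)]
  have hqe : q = t * r₂ := by rw [hr2, Nat.mul_div_cancel' (ht ▸ Nat.gcd_dvd_right p q)]
  have hcop : Nat.Coprime r₁ r₂ := by
    rw [hr1, hr2, ht]; exact Nat.coprime_div_gcd_div_gcd (ht ▸ ht0)
  have hMpos : 0 < M := by
    have := hS hM; rw [Finset.mem_Icc] at this; omega
  obtain ⟨m, rfl⟩ := htM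
  have hm0 : 0 < m := Nat.pos_of_mul_pos_left hMpos
  have hr20 : 0 < r₂ := by
    rcases Nat.eq_zero_or_pos r₂ with h | h
    · rw [h] at hqe; omega
    · exact h
  have hle : r₂ ≤ r₁ := by
    rw [hpe, hqe] at hqp; exact Nat.le_of_mul_le_mul_left hqp ht0
  have hr10 : 0 < r₁ := by omega
  clear hr1 hr2 ht hgcd
  subst hpe hqe
  set N := r * m with hN
  have hN0 : 0 < N := Nat.mul_pos hr hm0
  have htQ : (t : ℚ) ≠ 0 := by positivity
  have h1Q : (r₁ : ℚ) ≠ 0 := by positivity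
  have h2Q : (r₂ : ℚ) ≠ 0 := by positivity
  have e1 : ((r : ℚ) * ((t * m : ℕ) : ℚ)) / ((t * r₂ : ℕ) : ℚ) = (N : ℚ) / r₂ := by
    rw [hN]; push_cast; field_simp
  have e2 : ((r : ℚ) * ((t * m : ℕ) : ℚ)) / (r₁ * (((t * r₁ : ℕ) : ℚ) + ((t * r₂ : ℕ) : ℚ)))
      = (N : ℚ) / (r₁ * (r₁ + r₂)) := by
    have : (r₁ : ℚ) + r₂ ≠ 0 := by positivity
    rw [hN]; push_cast; rw [← mul_add]; field_simp
  have e3 : r * (t * m) / (r₂ * (t * r₁ + t * r₂)) = N / (r₁ + r₂) / r₂ := by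
    rw [Nat.div_div_eq_div_mul, hN, ← mul_add,
      show r * (t * m) = t * (r * m) by ring,
      show r₂ * (t * (r₁ + r₂)) = t * ((r₁ + r₂) * r₂) by ring, Nat.mul_div_mul_left _ _ ht0]
  rw [e1, e2, e3]
  have hc1 : 0 < ⌈(N : ℚ) / r₂⌉ := Int.ceil_pos.mpr (by positivity)
  obtain ⟨K, hK⟩ : ∃ K : ℕ, ⌈(N : ℚ) / r₂⌉ - 1 = K :=
    ⟨(⌈(N : ℚ) / r₂⌉ - 1).toNat, by omega⟩
  rw [hK]
  have hKx : ∀ x, x ≤ K ↔ x * r₂ < N := by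
    intro x
    have : x ≤ K ↔ (x : ℤ) < ⌈(N : ℚ) / r₂⌉ := by omega
    rw [this, Int.lt_ceil, lt_div_iff₀ (by positivity)]
    exact_mod_cast Iff.rfl
  have hcore := core r₁ r₂ N K hr20 hle hN0 hcop hKx S
    (fun x hx => by have := hS hx; rw [Finset.mem_Icc] at this; omega)
    (fun x hx y hy he => hfree x hx y hy _ hM (by rw [hN] at he; linear_combination t * he))
  simp only [Nat.cast_le]
  have hfl : Int.fdiv ⌊(N : ℚ) / (r₁ * (r₁ + r₂)) - 1 / r₂⌋ (r₁ * r₂) ≤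
      ((N / (r₁ + r₂) / (r₁ ^ 2 * r₂) : ℕ) : ℤ) := by
    rw [Int.fdiv_eq_ediv_of_nonneg _ (by positivity)]
    have : ⌊(N : ℚ) / (r₁ * (r₁ + r₂)) - 1 / r₂⌋ ≤ ((N / (r₁ * (r₁ + r₂)) : ℕ) : ℤ) := by
      have h1 : ⌊(N : ℚ) / (r₁ * (r₁ + r₂)) - 1 / r₂⌋ ≤ ⌊(N : ℚ) / ((r₁ * (r₁ + r₂) : ℕ) : ℚ)⌋ := by
        apply Int.floor_le_floor
        push_cast
        have : (0 : ℚ) ≤ 1 / r₂ := by positivity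
        linarith
      rwa [Rat.floor_natCast_div_natCast] at h1
    calc _ ≤ ((N / (r₁ * (r₁ + r₂)) : ℕ) : ℤ) / (r₁ * r₂) :=
          Int.ediv_le_ediv (by positivity) this
      _ = _ := by
        rw [← Nat.cast_mul, ← Int.natCast_div, Nat.div_div_eq_div_mul, Nat.div_div_eq_div_mul]
        congr 2; ring
  have hfac : ((r₁ : ℤ) * r₂ - r₁ - r₂ + 1) = (((r₁ - 1) * (r₂ - 1) : ℕ) : ℤ) := by
    push_cast [Nat.cast_sub (show 1 ≤ r₁ from hr10), Nat.cast_sub (show 1 ≤ r₂ from hr20)]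
    ring
  rw [hfac]
  have hmul := mul_le_mul_of_nonneg_left hfl (Int.natCast_nonneg ((r₁ - 1) * (r₂ - 1)))
  have hcore' : ((S.filter (fun x => x ≤ K)).card : ℤ) + ((N / (r₁ + r₂) / r₂ : ℕ) : ℤ) +
      ((N / (r₁ + r₂) / (r₁ ^ 2 * r₂) : ℕ) : ℤ) * (((r₁ - 1) * (r₂ - 1) : ℕ) : ℤ) ≤ K := by
    rw [← Nat.cast_mul]
    have := hcore
    convert Int.ofNat_le.mpr this using 1
    push_cast
    congr!
  linarith
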